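/- Under the exclusive policy, let A★ be the strategy defined for k players, let k′ ≥ 1, and let ε > 0. If f(1)/f(M) ≤ (1+ε)^{(k−1)/k′}, then A★ is a (1+ε)-equilibrium when played by k+k′ players: for every strategy B, U_{A★^{k+k′−1}}(B) ≤ (1+ε)·U_{A★^{k+k′−1}}(A★), where utilities are computed against k+k′−1 copies of A★. -/

import Mathlib

open Finset

/-- `A` is a doubly-substochastic `M × T` matrix: boxes `1..M`, rounds `1..T`,
nonnegative entries, every row and every column sums to at most 1. -/
def Substochastic (M T : ℕ) (A : ℕ → ℕ → ℝ) : Prop :=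
  (∀ x t, 0 ≤ A x t) ∧
  (∀ x ∈ Icc 1 M, ∑ t ∈ Icc 1 T, A x t ≤ 1) ∧
  (∀ t ∈ Icc 1 T, ∑ x ∈ Icc 1 M, A x t ≤ 1)

/-- `N̄_A(x,t)`: the probability that `A` does not visit box `x` by (and including) round `t`. -/
def Nbar (A : ℕ → ℕ → ℝ) (x t : ℕ) : ℝ := 1 - ∑ s ∈ Icc 1 t, A x s

/-- `f` is a positive, nonincreasing probability distribution on boxes `1..M`. -/
def BoxDist (M : ℕ) (f : ℕ → ℝ) : Prop :=
  (∀ x ∈ Icc 1 M, 0 < f x) ∧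
  (∀ x, 1 ≤ x → x + 1 ≤ M → f (x + 1) ≤ f x) ∧
  (∑ x ∈ Icc 1 M, f x = 1)

/-- `C` is a congestion policy for `k` players: nonnegative, nonincreasing on `1..k`,
`C 1 = 1`, and `C ℓ < 1` for some `ℓ ≤ k`. -/
def Policy (k : ℕ) (C : ℕ → ℝ) : Prop :=
  (∀ ℓ, 1 ≤ ℓ → ℓ ≤ k → 0 ≤ C ℓ) ∧ (C 1 = 1) ∧
  (∀ ℓ ℓ', 1 ≤ ℓ → ℓ ≤ ℓ' → ℓ' ≤ k → C ℓ' ≤ C ℓ) ∧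
  (∃ ℓ, 1 ≤ ℓ ∧ ℓ ≤ k ∧ C ℓ < 1)

/-- The value of box `x` at round `t` against `k-1` copies of `A`. -/
def val (k : ℕ) (C f : ℕ → ℝ) (A : ℕ → ℕ → ℝ) (x t : ℕ) : ℝ :=
  f x * ∑ ℓ ∈ range k,
    C (ℓ + 1) * ((k - 1).choose ℓ : ℝ) * A x t ^ ℓ * Nbar A x t ^ (k - 1 - ℓ)

/-- The utility of `B` against `k-1` copies of `A`. -/
def util (M T k : ℕ) (C f : ℕ → ℝ) (A B : ℕ → ℕ → ℝ) : ℝ :=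
  ∑ t ∈ Icc 1 T, ∑ x ∈ Icc 1 M, B x t * val k C f A x t

/-- `A` is non-redundant: each column `t ≤ min T M` sums to exactly 1. -/
def NonRedundant (M T : ℕ) (A : ℕ → ℕ → ℝ) : Prop :=
  ∀ t, 1 ≤ t → t ≤ min T M → ∑ x ∈ Icc 1 M, A x t = 1

/-- `A` is self-greedy: for each round `t ≤ T` it is greedy at round `t` with respect to
`k-1` copies of itself. -/
def SGreedy (M T k : ℕ) (C f : ℕ → ℝ) (A : ℕ → ℕ → ℝ) : Prop :=
  ∀ t, 1 ≤ t → t ≤ T → ∀ B, Substochastic M T B →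
    (∀ x s, s < t → B x s = A x s) →
    ∑ x ∈ Icc 1 M, B x t * val k C f A x t ≤ ∑ x ∈ Icc 1 M, A x t * val k C f A x t

/-- The utility of `B` against `m` copies of `A` under the exclusive policy. -/
def exUtilM (M T m : ℕ) (f : ℕ → ℝ) (A B : ℕ → ℕ → ℝ) : ℝ :=
  ∑ t ∈ Icc 1 T, ∑ x ∈ Icc 1 M, B x t * (f x * Nbar A x t ^ m)

/-- `A` is the strategy `A★` of [JACM] for `k` players. -/
def IsAstar (M T k : ℕ) (f : ℕ → ℝ) (A : ℕ → ℕ → ℝ) : Prop :=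
  Substochastic M T A ∧
  (∀ x ∈ Icc 1 M, ∀ t ∈ Icc 1 T, M < t → A x t = 0) ∧
  (∀ t, 1 ≤ t → t ≤ min T M → ∃ α : ℝ, 0 ≤ α ∧
    (∀ x ∈ Icc 1 M, Nbar A x t = min 1 (α * f x ^ (-(1 : ℝ) / ((k : ℝ) - 1)))) ∧
    (∑ x ∈ Icc 1 M, Nbar A x t = (M : ℝ) - (t : ℝ)))

theorem BoxDist.anti {M : ℕ} {f : ℕ → ℝ} (hf : BoxDist M f) {x y : ℕ} (hx : 1 ≤ x)
    (hxy : x ≤ y) (hy : y ≤ M) : f y ≤ f x := by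
  induction y, hxy using Nat.le_induction with
  | base => exact le_rfl
  | succ n hn ih => exact (hf.2.1 n (hx.trans hn) hy).trans (ih (by omega))

theorem Nbar_succ (A : ℕ → ℕ → ℝ) (x t : ℕ) : Nbar A x (t + 1) = Nbar A x t - A x (t + 1) := by
  simp only [Nbar, Finset.sum_Icc_succ_top (Nat.le_add_left 1 t)]
  ring

theorem Nbar_antitone {A : ℕ → ℕ → ℝ} (hA : ∀ x t, 0 ≤ A x t) (x : ℕ) :
    Antitone (Nbar A x) :=
  antitone_nat_of_succ_le fun t => by rw [Nbar_succ]; linarith [hA x (t + 1)]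

theorem Nbar_nonneg {M T : ℕ} {A : ℕ → ℕ → ℝ} (hA : Substochastic M T A) {x t : ℕ}
    (hx : x ∈ Icc 1 M) (ht : t ≤ T) : 0 ≤ Nbar A x t := by
  have h := Nbar_antitone hA.1 x ht
  have hrow := hA.2.1 x hx
  have hT : 0 ≤ Nbar A x T := by unfold Nbar; linarith
  exact hT.trans h

theorem IsAstar.sum_Nbar {M T k : ℕ} {f : ℕ → ℝ} {A : ℕ → ℕ → ℝ} (hA : IsAstar M T k f A)
    {t : ℕ} (ht : t ≤ min T M) : ∑ x ∈ Icc 1 M, Nbar A x t = (M : ℝ) - t := by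
  rcases Nat.eq_zero_or_pos t with rfl | h
  · simp [Nbar]
  · obtain ⟨_, _, _, h⟩ := hA.2.2 t h ht
    exact h

theorem IsAstar.column_sum {M T k : ℕ} {f : ℕ → ℝ} {A : ℕ → ℕ → ℝ} (hA : IsAstar M T k f A)
    {t : ℕ} (ht : t + 1 ≤ min T M) : ∑ x ∈ Icc 1 M, A x (t + 1) = 1 := by
  have h₀ := hA.sum_Nbar (show t ≤ min T M by omega)
  have h₁ := hA.sum_Nbar ht
  simp only [Nbar_succ, Finset.sum_sub_distrib] at h₁
  push_cast at h₁
  linarith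

/-- After round `M` every box has been visited by `A★`. -/
theorem IsAstar.Nbar_eq_zero {M T k : ℕ} {f : ℕ → ℝ} {A : ℕ → ℕ → ℝ} (hA : IsAstar M T k f A)
    {x t : ℕ} (hx : x ∈ Icc 1 M) (hMt : M ≤ t) (ht : t ≤ T) : Nbar A x t = 0 := by
  have hsum := hA.sum_Nbar (show M ≤ min T M by omega)
  rw [sub_self, Finset.sum_eq_zero_iff_of_nonneg
    fun y hy => Nbar_nonneg hA.1 hy (hMt.trans ht)] at hsum
  exact le_antisymm ((Nbar_antitone hA.1.1 x hMt).trans_eq (hsum x hx)) (Nbar_nonneg hA.1 hx ht)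

/-- A strategy whose positive entries lie on boxes of value at least `c` obtains, up to a factor
`1 + ε`, at least as much as any other strategy if no box has value more than `(1 + ε) * c`. -/
theorem sum_mul_le_of_value_bounds {ι : Type*} {s : Finset ι} {a b v : ι → ℝ} {c ε : ℝ}
    (hc : 0 ≤ (1 + ε) * c) (hε : 0 ≤ 1 + ε) (hb : ∀ x ∈ s, 0 ≤ b x) (hb1 : ∑ x ∈ s, b x ≤ 1)
    (ha1 : ∑ x ∈ s, a x = 1) (hup : ∀ x ∈ s, v x ≤ (1 + ε) * c)
    (hlow : ∀ x ∈ s, a x * c ≤ a x * v x) :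
    ∑ x ∈ s, b x * v x ≤ (1 + ε) * ∑ x ∈ s, a x * v x :=
  calc ∑ x ∈ s, b x * v x ≤ ∑ x ∈ s, b x * ((1 + ε) * c) :=
        Finset.sum_le_sum fun x hx => mul_le_mul_of_nonneg_left (hup x hx) (hb x hx)
    _ = (∑ x ∈ s, b x) * ((1 + ε) * c) := (Finset.sum_mul ..).symm
    _ ≤ (1 + ε) * c := mul_le_of_le_one_left hc hb1
    _ = (1 + ε) * ∑ x ∈ s, a x * c := by rw [← Finset.sum_mul, ha1, one_mul]
    _ ≤ (1 + ε) * ∑ x ∈ s, a x * v x :=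
        mul_le_mul_of_nonneg_left (Finset.sum_le_sum hlow) hε

theorem mul_rpow_neg_one_div_pow {y : ℝ} (hy : 0 < y) {n : ℕ} (hn : n ≠ 0) :
    y * (y ^ (-(1 : ℝ) / n)) ^ n = 1 := by
  have hn' : (n : ℝ) ≠ 0 := Nat.cast_ne_zero.mpr hn
  rw [← Real.rpow_natCast, ← Real.rpow_mul hy.le, div_mul_cancel₀ _ hn', Real.rpow_neg_one,
    mul_inv_cancel₀ hy.ne']

theorem rpow_neg_one_div_pow_le {y z b : ℝ} (hy : 0 < y) (hz : 0 < z) (hb : 0 ≤ b) {n m : ℕ}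
    (hn : n ≠ 0) (hm : m ≠ 0) (h : z / y ≤ b ^ ((n : ℝ) / m)) :
    (y ^ (-(1 : ℝ) / n)) ^ m ≤ b * (z ^ (-(1 : ℝ) / n)) ^ m := by
  have hn' : (n : ℝ) ≠ 0 := Nat.cast_ne_zero.mpr hn
  have hm' : (m : ℝ) ≠ 0 := Nat.cast_ne_zero.mpr hm
  have key : (z / y) ^ ((m : ℝ) / n) ≤ b := by
    calc (z / y) ^ ((m : ℝ) / n) ≤ (b ^ ((n : ℝ) / m)) ^ ((m : ℝ) / n) := by gcongr
      _ = b := by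
        rw [← Real.rpow_mul hb, div_mul_div_cancel₀ hm', div_self hn', Real.rpow_one]
  have pow_eq (w : ℝ) (hw : 0 < w) : (w ^ (-(1 : ℝ) / n)) ^ m = (w ^ ((m : ℝ) / n))⁻¹ := by
    rw [← Real.rpow_natCast, ← Real.rpow_mul hw.le, ← Real.rpow_neg hw.le]
    ring_nf
  rw [Real.div_rpow hz.le hy.le, div_eq_mul_inv, ← pow_eq y hy] at key
  rw [pow_eq z hz, ← div_eq_mul_inv, le_div_iff₀ (by positivity), mul_comm]
  exact key

/-- if `f(1)/f(M) ≤ (1+ε)^{(k-1)/k'}`, then `A★` (designed for `k` players) is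
a `(1+ε)`-equilibrium when played by `k + k'` players. -/
theorem Astar_robust
    (M T k k' : ℕ) (hM : 1 ≤ M) (hT : 1 ≤ T) (hk : 2 ≤ k) (hk' : 1 ≤ k')
    (f : ℕ → ℝ) (hf : BoxDist M f)
    (ε : ℝ) (hε : 0 < ε)
    (hratio : f 1 / f M ≤ (1 + ε) ^ (((k : ℝ) - 1) / (k' : ℝ)))
    (Astar : ℕ → ℕ → ℝ) (hAstar : IsAstar M T k f Astar) :
    ∀ B, Substochastic M T B →
      exUtilM M T (k + k' - 1) f Astar B ≤
        (1 + ε) * exUtilM M T (k + k' - 1) f Astar Astar := by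
  intro B hB
  obtain ⟨n, rfl⟩ : ∃ n, k = n + 1 := ⟨k - 1, by omega⟩
  have hn : n ≠ 0 := by omega
  have hexp : n + 1 + k' - 1 = n + k' := by omega
  have hcast : ((n + 1 : ℕ) : ℝ) - 1 = n := by push_cast; ring
  rw [hcast] at hratio
  have hM1 : 1 ∈ Icc 1 M := by simp [hM]
  have hMM : M ∈ Icc 1 M := by simp [hM]
  set g : ℕ → ℝ := fun x => f x ^ (-(1 : ℝ) / n)
  have hgpos : ∀ x ∈ Icc 1 M, 0 < g x := fun x hx => Real.rpow_pos_of_pos (hf.1 x hx) _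
  have hgmono : ∀ x ∈ Icc 1 M, ∀ y ∈ Icc 1 M, x ≤ y → g x ≤ g y := fun x hx y hy hxy =>
    Real.rpow_le_rpow_of_nonpos (hf.1 y hy)
      (hf.anti (Finset.mem_Icc.mp hx).1 hxy (Finset.mem_Icc.mp hy).2)
      (div_nonpos_of_nonpos_of_nonneg (by norm_num) n.cast_nonneg)
  have hgratio : g M ^ k' ≤ (1 + ε) * g 1 ^ k' :=
    rpow_neg_one_div_pow_le (hf.1 M hMM) (hf.1 1 hM1) (by linarith) hn (by omega) hratio
  have hvalue : ∀ x ∈ Icc 1 M, ∀ α : ℝ, f x * (α * g x) ^ (n + k') = α ^ (n + k') * g x ^ k' := by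
    intro x hx α
    have h := mul_rpow_neg_one_div_pow (hf.1 x hx) hn
    calc f x * (α * g x) ^ (n + k') = α ^ (n + k') * g x ^ k' * (f x * g x ^ n) := by ring
      _ = α ^ (n + k') * g x ^ k' := by rw [h, mul_one]
  unfold exUtilM
  rw [hexp, Finset.mul_sum]
  refine Finset.sum_le_sum fun t ht => ?_
  obtain ⟨ht1, htT⟩ := Finset.mem_Icc.mp ht
  rcases le_or_gt t M with htM | htM
  · have htTM : t ≤ min T M := le_min htT htM
    obtain ⟨α, hα, hN, -⟩ := hAstar.2.2 t ht1 htTM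
    simp only [hcast] at hN
    obtain ⟨s, rfl⟩ : ∃ s, t = s + 1 := ⟨t - 1, by omega⟩
    refine sum_mul_le_of_value_bounds (c := α ^ (n + k') * g 1 ^ k') ?_ (by linarith)
      (fun x _ => hB.1 x _) (hB.2.2 _ ht) (hAstar.column_sum htTM) ?_ ?_
    · have := hgpos 1 hM1
      positivity
    · intro x hx
      have hfx := hf.1 x hx
      have hgx := hgpos x hx
      calc f x * Nbar Astar x (s + 1) ^ (n + k') ≤ f x * (α * g x) ^ (n + k') := by
            gcongr
            · exact Nbar_nonneg hAstar.1 hx htT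
            · rw [hN x hx]; exact min_le_right _ _
        _ = α ^ (n + k') * g x ^ k' := hvalue x hx α
        _ ≤ α ^ (n + k') * g M ^ k' := by
            gcongr
            exact hgmono x hx M hMM (Finset.mem_Icc.mp hx).2
        _ ≤ α ^ (n + k') * ((1 + ε) * g 1 ^ k') := by gcongr
        _ = (1 + ε) * (α ^ (n + k') * g 1 ^ k') := by ring
    · intro x hx
      rcases (hAstar.1.1 x (s + 1)).eq_or_lt with h0 | hpos
      · rw [← h0, zero_mul, zero_mul]
      · have hlt : Nbar Astar x (s + 1) < 1 := by
          have h := Nbar_antitone hAstar.1.1 x (Nat.zero_le s)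
          have h0 : Nbar Astar x 0 = 1 := by simp [Nbar]
          rw [Nbar_succ]
          linarith
        have heq : Nbar Astar x (s + 1) = α * g x := by
          rw [hN x hx] at hlt ⊢
          exact min_eq_right ((min_lt_iff.mp hlt).resolve_left (lt_irrefl _)).le
        rw [heq, hvalue x hx]
        have hg1 := hgpos 1 hM1
        gcongr
        exact hgmono 1 hM1 x hx (Finset.mem_Icc.mp hx).1
  · have hzero : ∀ D : ℕ → ℕ → ℝ,
        ∑ x ∈ Icc 1 M, D x t * (f x * Nbar Astar x t ^ (n + k')) = 0 := fun D =>
      Finset.sum_eq_zero fun x hx => by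
        rw [hAstar.Nbar_eq_zero hx htM.le htT, zero_pow (by omega), mul_zero, mul_zero]
    rw [hzero, hzero, mul_zero]
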